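/- Let p ∈ (0,∞) and φ ∈ Cvx(ℝⁿ). For x ∈ ℝⁿ, the integral ∫_{ℝⁿ} e^{−(T_x φ)^{*,p}(y)} dy (equivalently, M_p(T_x φ)) is finite if and only if x lies in the interior of the set {z ∈ ℝⁿ : φ(z) < +∞}. -/

import Mathlib

open MeasureTheory Real Filter
open scoped ENNReal RealInnerProductSpace Classical

noncomputable section

abbrev Euc (n : ℕ) : Type := EuclideanSpace ℝ (Fin n)

/-- `e^t` as an extended nonnegative real, for `t : EReal` (`e^{-∞}=0`, `e^{+∞}=∞`). -/
def erealExp (t : EReal) : ℝ≥0∞ :=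
  if t = ⊥ then 0 else if t = ⊤ then ⊤ else ENNReal.ofReal (Real.exp t.toReal)

/-- The volume `V(f) = ∫ e^{-f}` of `f : ℝⁿ → ℝ ∪ {+∞}`, as an extended nonnegative real. -/
def VolE {n : ℕ} (f : Euc n → EReal) : ℝ≥0∞ := ∫⁻ x, erealExp (-(f x))

/-- The volume `V(f) = ∫ e^{-f}` as a real number. -/
def Vol {n : ℕ} (f : Euc n → EReal) : ℝ := (VolE f).toReal

/-- `∫ e^{p⟨x,y⟩ - (p+1) f(x)} dx`. -/
def LpIntE {n : ℕ} (p : ℝ) (f : Euc n → EReal) (y : Euc n) : ℝ≥0∞ :=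
  ∫⁻ x, erealExp (((p * ⟪x, y⟫ : ℝ) : EReal) - ((p + 1 : ℝ) : EReal) * f x)

/-- The `L^p`-Legendre transform
`f^{*,p}(y) = (1/p) log ( ∫ e^{p⟨x,y⟩ - (p+1) f(x)} dx / V(f) )`,
with value `+∞` when the integral diverges. -/
def LpStar {n : ℕ} (p : ℝ) (f : Euc n → EReal) (y : Euc n) : EReal :=
  if LpIntE p f y = ⊤ then ⊤
  else (((1 / p) * Real.log ((LpIntE p f y).toReal / Vol f) : ℝ) : EReal)

/-- The `L^p`-Mahler integral `M_p(f) = V(f) · V(f^{*,p})`, as an extended nonnegative real. -/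
def MpE {n : ℕ} (p : ℝ) (f : Euc n → EReal) : ℝ≥0∞ := VolE f * VolE (LpStar p f)

/-- The translate `(T_a f)(x) = f(x + a)`. -/
def Transl {n : ℕ} (a : Euc n) (f : Euc n → EReal) : Euc n → EReal := fun x => f (x + a)

/-- Convexity of an `ℝ ∪ {+∞}`-valued function. -/
def ConvexE {n : ℕ} (φ : Euc n → EReal) : Prop :=
  ∀ x y : Euc n, ∀ l : ℝ, 0 ≤ l → l ≤ 1 →
    φ ((1 - l) • x + l • y) ≤ ((1 - l : ℝ) : EReal) * φ x + ((l : ℝ) : EReal) * φ y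

/-- The class `Cvx(ℝⁿ)`: convex, lower semicontinuous functions `ℝⁿ → ℝ ∪ {+∞}`,
not identically `+∞`, with `0 < V(φ) < ∞`. -/
structure InCvx {n : ℕ} (φ : Euc n → EReal) : Prop where
  noBot : ∀ x, φ x ≠ ⊥
  convex : ConvexE φ
  lsc : LowerSemicontinuous φ
  proper : ∃ x, φ x ≠ ⊤
  volPos : 0 < VolE φ
  volFin : VolE φ < ⊤

/-- The barycenter `b(g) = ∫ x e^{-g(x)} dx / V(g)`. -/
def bary {n : ℕ} (g : Euc n → EReal) : Euc n :=
  (Vol g)⁻¹ • ∫ x, (erealExp (-(g x))).toReal • x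

/-- The classical Legendre transform `f^*(y) = sup_x (⟨x,y⟩ - f(x))`. -/
def Lstar {n : ℕ} (f : Euc n → EReal) (y : Euc n) : EReal :=
  ⨆ x : Euc n, (((⟪x, y⟫ : ℝ) : EReal) - f x)




lemma erealExp_eq (t : EReal) : erealExp t = EReal.exp t := by
  induction t with
  | bot => simp [erealExp]
  | coe t => simp [erealExp]
  | top => simp [erealExp]

lemma erealExp_coe (t : ℝ) : erealExp (t : EReal) = ENNReal.ofReal (Real.exp t) := by
  rw [erealExp_eq, EReal.exp_coe]

lemma erealExp_mono {s t : EReal} (h : s ≤ t) : erealExp s ≤ erealExp t := by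
  rw [erealExp_eq, erealExp_eq]; exact EReal.exp_monotone h

lemma sublevel_convexE {n : ℕ} {f : Euc n → EReal} (hc : ConvexE f) {x y : Euc n} {M l : ℝ}
    (hx : f x ≤ M) (hy : f y ≤ M) (h0 : 0 ≤ l) (h1 : l ≤ 1) :
    f ((1 - l) • x + l • y) ≤ M := by
  refine (hc x y l h0 h1).trans ?_
  have e : (M : EReal) = ((1 - l : ℝ) : EReal) * M + (l : EReal) * M := by
    rw [← EReal.coe_mul, ← EReal.coe_mul, ← EReal.coe_add]; congr 1; ring
  rw [e]
  have a1 : (0 : EReal) ≤ ((1 - l : ℝ) : EReal) := by exact_mod_cast sub_nonneg.2 h1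
  have a2 : (0 : EReal) ≤ (l : EReal) := by exact_mod_cast h0
  exact add_le_add (mul_le_mul_of_nonneg_left hx a1) (mul_le_mul_of_nonneg_left hy a2)

lemma convexOn_toReal {n : ℕ} {f : Euc n → EReal} (hb : ∀ x, f x ≠ ⊥) (hc : ConvexE f) :
    ConvexOn ℝ {z : Euc n | f z ≠ ⊤} (fun z => (f z).toReal) := by
  have key : ∀ x y : Euc n, f x ≠ ⊤ → f y ≠ ⊤ → ∀ l : ℝ, 0 ≤ l → l ≤ 1 →
      f ((1 - l) • x + l • y) ≤ (((1 - l) * (f x).toReal + l * (f y).toReal : ℝ) : EReal) := by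
    intro x y hx hy l h0 h1
    have := hc x y l h0 h1
    rw [← EReal.coe_toReal hx (hb x), ← EReal.coe_toReal hy (hb y)] at this
    simpa only [EReal.toReal_coe, EReal.coe_add, EReal.coe_mul] using this
  constructor
  · intro x hx y hy a b ha hbb hab
    obtain rfl : a = 1 - b := by linarith
    exact ne_top_of_le_ne_top (EReal.coe_ne_top _) (key x y hx hy b hbb (by linarith))
  · intro x hx y hy a b ha hbb hab
    obtain rfl : a = 1 - b := by linarith
    have := key x y hx hy b hbb (by linarith)
    simp only [smul_eq_mul]
    have h2 := EReal.toReal_le_toReal this (hb _) (EReal.coe_ne_top _)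
    simpa only [EReal.toReal_coe] using h2

lemma local_bound {n : ℕ} {f : Euc n → EReal} (hb : ∀ x, f x ≠ ⊥) (hc : ConvexE f) {x0 : Euc n}
    (h0 : x0 ∈ interior {z : Euc n | f z ≠ ⊤}) :
    ∃ r C : ℝ, 0 < r ∧ ∀ z ∈ Metric.ball x0 r, f z ≤ (C : EReal) := by
  have hcont := (convexOn_toReal hb hc).continuousOn_interior
  have hat := hcont.continuousAt (isOpen_interior.mem_nhds h0)
  have h1 := hat.eventually (gt_mem_nhds (lt_add_one ((f x0).toReal)))
  have h2 := h1.and (isOpen_interior.mem_nhds h0)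
  obtain ⟨r, hr, h⟩ := Metric.eventually_nhds_iff_ball.1 h2
  refine ⟨r, (f x0).toReal + 1, hr, fun z hz => ?_⟩
  obtain ⟨ha, hd⟩ := h z hz
  have hd' : f z ≠ ⊤ := interior_subset hd
  rw [← EReal.coe_toReal hd' (hb z)]
  exact_mod_cast ha.le

lemma interior_nonempty {n : ℕ} {f : Euc n → EReal} (hf : InCvx f) :
    (interior {z : Euc n | f z ≠ ⊤}).Nonempty := by
  by_contra hne
  rw [Set.not_nonempty_iff_eq_empty] at hne
  have hcv := (convexOn_toReal hf.noBot hf.convex).1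
  have h0 := hcv.addHaar_frontier (volume : Measure (Euc n))
  have hsub : {z : Euc n | f z ≠ ⊤} ⊆ frontier {z : Euc n | f z ≠ ⊤} := by
    rw [frontier, hne, Set.sdiff_empty]; exact subset_closure
  have h1 := measure_mono_null hsub h0
  have : VolE f = 0 := by
    unfold VolE
    have hae : (fun x => erealExp (-(f x))) =ᵐ[volume] fun _ => 0 := by
      have : ∀ᵐ x : Euc n, f x = ⊤ := by
        rw [ae_iff]; exact h1
      filter_upwards [this] with x hx
      rw [hx]; simp [erealExp]
    rw [lintegral_congr_ae hae]; simp
  exact hf.volPos.ne' this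

lemma balls_lintegral {n : ℕ} (h : Euc n → ℝ≥0∞) (c : ℝ≥0∞) (x0 e : Euc n) (he : ‖e‖ = 1)
    (r : ℝ) (hr : 0 < r) (N : ℕ)
    (hh : ∀ k < N, ∀ z ∈ Metric.ball (x0 + ((k : ℝ) * r) • e) (r / 2), c ≤ h z) :
    (N : ℝ≥0∞) * (c * volume (Metric.ball (0 : Euc n) (r / 2))) ≤ ∫⁻ z, h z := by
  set B : ℕ → Set (Euc n) := fun k => Metric.ball (x0 + ((k : ℝ) * r) • e) (r / 2) with hB
  have hd : Set.PairwiseDisjoint (↑(Finset.range N) : Set ℕ) B := by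
    intro i _ j _ hij
    apply Metric.ball_disjoint_ball
    rw [dist_add_left, dist_eq_norm, ← sub_smul, norm_smul, he, mul_one, ← sub_mul, norm_mul,
      Real.norm_of_nonneg hr.le]
    have : (1 : ℝ) ≤ ‖(i : ℝ) - j‖ := by
      have h1 : (1 : ℤ) ≤ |(i : ℤ) - j| := Int.one_le_abs (by omega)
      rw [Real.norm_eq_abs]
      exact_mod_cast h1
    nlinarith
  have hmeas : volume (⋃ k ∈ Finset.range N, B k)
      = (N : ℝ≥0∞) * volume (Metric.ball (0 : Euc n) (r / 2)) := by
    rw [measure_biUnion_finset hd (fun _ _ => measurableSet_ball)]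
    simp [hB, Measure.addHaar_ball_center]
  calc (N : ℝ≥0∞) * (c * volume (Metric.ball (0 : Euc n) (r / 2)))
      = ∫⁻ _ in ⋃ k ∈ Finset.range N, B k, c := by
        rw [setLIntegral_const, hmeas]; ring
    _ ≤ ∫⁻ z in ⋃ k ∈ Finset.range N, B k, h z := by
        apply setLIntegral_mono' (Finset.measurableSet_biUnion _ fun _ _ => measurableSet_ball)
        intro z hz
        simp only [Set.mem_iUnion, Finset.mem_range] at hz
        obtain ⟨k, hk, hz⟩ := hz
        exact hh k hk z hz
    _ ≤ _ := setLIntegral_le_lintegral _ _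

lemma lintegral_exp_norm (n : ℕ) (a b : ℝ) (ha : 0 < a) :
    ∫⁻ x : Euc n, ENNReal.ofReal (Real.exp (-a * ‖x‖ + b)) < ⊤ := by
  have hi : Integrable (fun x : Euc n => (Real.exp (a + b) * (n + 1).factorial / a ^ (n + 1)) *
      (1 + ‖x‖) ^ (-((n + 1 : ℕ) : ℝ))) := by
    apply Integrable.const_mul
    apply integrable_one_add_norm
    simp
  refine lt_of_le_of_lt (lintegral_mono fun x => ?_) hi.lintegral_lt_top
  apply ENNReal.ofReal_le_ofReal
  have hx := norm_nonneg x
  have h := Real.pow_div_factorial_le_exp (a * (1 + ‖x‖)) (by positivity) (n + 1)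
  rw [Real.rpow_neg (by positivity), Real.rpow_natCast]
  have e1 : Real.exp (-a * ‖x‖ + b) = Real.exp (a + b) / Real.exp (a * (1 + ‖x‖)) := by
    rw [← Real.exp_sub]; congr 1; ring
  rw [e1, div_le_iff₀ (Real.exp_pos _)]
  have hq : 0 < Real.exp (a + b) * (n + 1).factorial / a ^ (n + 1) * ((1 + ‖x‖) ^ (n + 1))⁻¹ := by
    positivity
  refine le_trans (le_of_eq ?_) (mul_le_mul_of_nonneg_left h hq.le)
  have : (1 + ‖x‖) ≠ 0 := by positivity
  have h3 : ((n + 1).factorial : ℝ) ≠ 0 := by positivity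
  rw [mul_pow]
  field_simp

lemma sublevel_bdd {n : ℕ} {f : Euc n → EReal} (hf : InCvx f) {x0 : Euc n} {r M : ℝ} (hr : 0 < r)
    (hM : ∀ z ∈ Metric.ball x0 r, f z ≤ (M : EReal)) :
    ∃ R : ℝ, 0 < R ∧ ∀ z, R ≤ ‖z - x0‖ → (M : EReal) < f z := by
  set c := ENNReal.ofReal (Real.exp (-M)) * volume (Metric.ball (0 : Euc n) (r / 2)) with hcdef
  have hc0 : c ≠ 0 := by
    apply mul_ne_zero
    · simp [Real.exp_pos]
    · exact (Metric.measure_ball_pos _ _ (by positivity)).ne'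
  obtain ⟨N, hN⟩ := ENNReal.exists_nat_mul_gt hc0 hf.volFin.ne
  refine ⟨2 * r * N + 1, by positivity, fun z hz => ?_⟩
  by_contra hlt
  have hlt := not_lt.1 hlt
  set d := ‖z - x0‖ with hd
  have hrN : 0 ≤ 2 * r * N := by positivity
  have hdpos : 0 < d := by linarith
  refine absurd (balls_lintegral (fun x => erealExp (-(f x))) (ENNReal.ofReal (Real.exp (-M)))
    x0 (d⁻¹ • (z - x0)) ?_ r hr N ?_) (not_le.2 hN)
  · rw [norm_smul, norm_inv, Real.norm_of_nonneg hdpos.le, ← hd, inv_mul_cancel₀ hdpos.ne']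
  · intro k hk w hw
    have hk' : (k : ℝ) ≤ N := by exact_mod_cast hk.le
    set t := (k : ℝ) * r / d with ht
    have ht0 : 0 ≤ t := by positivity
    have ht1 : t ≤ 1 / 2 := by
      rw [ht, div_le_iff₀ hdpos]; nlinarith
    have h1t : 0 < 1 - t := by linarith
    set v := w - (x0 + ((k : ℝ) * r) • d⁻¹ • (z - x0)) with hv
    have hvn : ‖v‖ < r / 2 := by
      rw [hv, ← dist_eq_norm]; exact hw
    have hwe : w = (1 - t) • (x0 + (1 - t)⁻¹ • v) + t • z := by
      rw [smul_add, smul_smul, mul_inv_cancel₀ h1t.ne', one_smul, hv, smul_smul, ← div_eq_mul_inv,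
        ← ht]
      module
    have hq : f (x0 + (1 - t)⁻¹ • v) ≤ (M : EReal) := by
      apply hM
      rw [Metric.mem_ball, dist_eq_norm, add_sub_cancel_left, norm_smul, norm_inv,
        Real.norm_of_nonneg h1t.le, inv_mul_lt_iff₀ h1t]
      nlinarith
    have := sublevel_convexE hf.convex hq hlt ht0 (by linarith)
    rw [← hwe] at this
    rw [← erealExp_coe, EReal.coe_neg]
    exact erealExp_mono (EReal.neg_le_neg_iff.2 this)

lemma growth {n : ℕ} {f : Euc n → EReal} (hf : InCvx f) :
    ∃ a b : ℝ, 0 < a ∧ ∀ z, ((a * ‖z‖ - b : ℝ) : EReal) ≤ f z := by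
  obtain ⟨x0, hx0⟩ := interior_nonempty hf
  obtain ⟨r, C, hr, hC⟩ := local_bound hf.noBot hf.convex hx0
  obtain ⟨R, hR, hRz⟩ := sublevel_bdd (M := C + 1) hf hr (fun z hz => (hC z hz).trans
    (by exact_mod_cast (by linarith : C ≤ C + 1)))
  obtain ⟨m, _, hm⟩ := LowerSemicontinuousOn.exists_isMinOn (f := f) (s := Metric.closedBall x0 R)
    ⟨x0, by simp [hR.le]⟩ (isCompact_closedBall x0 R) (hf.lsc.lowerSemicontinuousOn _)
  obtain ⟨m', hm'⟩ : ∃ m' : ℝ, (m' : EReal) ≤ f m := by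
    have : f m ≠ ⊥ := hf.noBot m
    by_cases ht : f m = ⊤
    · exact ⟨0, by simp [ht]⟩
    · exact ⟨(f m).toReal, (EReal.coe_toReal ht this).le⟩
  refine ⟨R⁻¹, R⁻¹ * ‖x0‖ + 1 + |C| + |m'|, by positivity, fun z => ?_⟩
  have htri : ‖z‖ ≤ ‖z - x0‖ + ‖x0‖ := by
    simpa using norm_add_le (z - x0) x0
  have hRi : 0 < R⁻¹ := by positivity
  have htri' := mul_le_mul_of_nonneg_left htri hRi.le
  have hCa := neg_abs_le C
  have hma := neg_abs_le m'
  have hCp := abs_nonneg C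
  have hmp := abs_nonneg m'
  rcases le_total ‖z - x0‖ R with hz | hz
  · have h1 : f m ≤ f z := hm (by rw [Metric.mem_closedBall, dist_eq_norm]; exact hz)
    refine le_trans ?_ (hm'.trans h1)
    have : R⁻¹ * ‖z - x0‖ ≤ 1 := by rw [inv_mul_le_iff₀ hR]; linarith
    exact_mod_cast (by linarith)
  · by_cases ht : f z = ⊤
    · simp [ht]
    have hdp : 0 < ‖z - x0‖ := by linarith
    set t := R / ‖z - x0‖ with htd
    have ht0 : 0 < t := by positivity
    have ht1 : t ≤ 1 := by rw [htd, div_le_one hdp]; exact hz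
    have hx0C : f x0 ≤ (C : EReal) := hC x0 (by simp [hr])
    have hx0t : f x0 ≠ ⊤ := interior_subset hx0
    have hw := hRz ((1 - t) • x0 + t • z) (by
      have : (1 - t) • x0 + t • z - x0 = t • (z - x0) := by module
      rw [this, norm_smul, Real.norm_of_nonneg ht0.le, htd, div_mul_cancel₀ _ hdp.ne'])
    have hlt := lt_of_lt_of_le hw (hf.convex x0 z t ht0.le ht1)
    rw [← EReal.coe_toReal ht (hf.noBot z)]
    rw [← EReal.coe_toReal ht (hf.noBot z), ← EReal.coe_toReal hx0t (hf.noBot x0)] at hlt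
    rw [← EReal.coe_toReal hx0t (hf.noBot x0)] at hx0C
    have h2 : C + 1 < (1 - t) * (f x0).toReal + t * (f z).toReal := by exact_mod_cast hlt
    have h3 : (f x0).toReal ≤ C := by exact_mod_cast hx0C
    have h4 : C + 1 < (1 - t) * C + t * (f z).toReal := by nlinarith
    have h5 : R⁻¹ * ‖z - x0‖ < (f z).toReal - C := by
      have : R⁻¹ * ‖z - x0‖ = t⁻¹ := by rw [htd, inv_div]; field_simp
      rw [this, inv_lt_iff_one_lt_mul₀ ht0]; linarith
    exact_mod_cast (by linarith)

lemma volReal_pos {n : ℕ} {f : Euc n → EReal} (hf : InCvx f) : 0 < Vol f :=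
  ENNReal.toReal_pos hf.volPos.ne' hf.volFin.ne

lemma finite_of_mem {n : ℕ} {p : ℝ} (hp : 0 < p) {f : Euc n → EReal} (hf : InCvx f)
    (h0 : (0 : Euc n) ∈ interior {z : Euc n | f z ≠ ⊤}) : VolE (LpStar p f) < ⊤ := by
  obtain ⟨r, C, hr, hC⟩ := local_bound hf.noBot hf.convex h0
  have hV := volReal_pos hf
  set m := (volume (Metric.ball (0 : Euc n) (r / 4))).toReal with hm
  have hmtop : volume (Metric.ball (0 : Euc n) (r / 4)) ≠ ⊤ := measure_ball_lt_top.ne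
  have hmpos : 0 < m :=
    ENNReal.toReal_pos (Metric.measure_ball_pos _ _ (by positivity)).ne' hmtop
  have hlow : ∀ y : Euc n, ENNReal.ofReal (Real.exp (p * (r / 4 * ‖y‖) - (p + 1) * C) * m)
      ≤ LpIntE p f y := by
    intro y
    rw [ENNReal.ofReal_mul (Real.exp_pos _).le, hm, ENNReal.ofReal_toReal hmtop,
      ← Measure.addHaar_ball_center volume ((r / 2) • (‖y‖⁻¹ • y)), ← setLIntegral_const]
    refine le_trans (setLIntegral_mono' measurableSet_ball ?_) (setLIntegral_le_lintegral _ _)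
    intro x hx
    set q := (r / 2) • (‖y‖⁻¹ • y) with hq
    have hxq : ‖x - q‖ < r / 4 := by rw [← dist_eq_norm]; exact hx
    have hu : ‖‖y‖⁻¹ • y‖ ≤ 1 := by
      rw [norm_smul, norm_inv, norm_norm]; exact inv_mul_le_one
    have hqn : ‖q‖ ≤ r / 2 := by
      rw [hq, norm_smul, Real.norm_of_nonneg (by positivity)]
      nlinarith
    have hxr : x ∈ Metric.ball (0 : Euc n) r := by
      rw [mem_ball_zero_iff]
      have : ‖x‖ ≤ ‖x - q‖ + ‖q‖ := by simpa using norm_add_le (x - q) q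
      linarith
    have hqy : ⟪q, y⟫ = r / 2 * ‖y‖ := by
      rw [hq, real_inner_smul_left, real_inner_smul_left, real_inner_self_eq_norm_sq]
      by_cases hy : ‖y‖ = 0
      · simp [hy]
      · field_simp
    have hin : r / 4 * ‖y‖ ≤ ⟪x, y⟫ := by
      have e : ⟪x, y⟫ = ⟪x - q, y⟫ + ⟪q, y⟫ := by rw [← inner_add_left, sub_add_cancel]
      have h1 := neg_le_of_abs_le (abs_real_inner_le_norm (x - q) y)
      have h2 := mul_le_mul_of_nonneg_right hxq.le (norm_nonneg y)
      rw [e, hqy]; linarith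
    have hfx := hC x hxr
    have hft : f x ≠ ⊤ := ne_top_of_le_ne_top (EReal.coe_ne_top _) hfx
    rw [← EReal.coe_toReal hft (hf.noBot x)] at hfx ⊢
    have hfx' : (f x).toReal ≤ C := by exact_mod_cast hfx
    rw [← EReal.coe_mul, ← EReal.coe_sub, erealExp_coe]
    apply ENNReal.ofReal_le_ofReal
    apply Real.exp_le_exp.2
    have := mul_le_mul_of_nonneg_left hin hp.le
    have := mul_le_mul_of_nonneg_left hfx' (by linarith : 0 ≤ p + 1)
    linarith
  refine lt_of_le_of_lt (lintegral_mono fun y => ?_)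
    (lintegral_exp_norm n (r / 4) (1 / p * ((p + 1) * C - Real.log (m / Vol f))) (by positivity))
  unfold LpStar
  split_ifs with htop
  · simp [erealExp]
  · have hL := (ENNReal.ofReal_le_iff_le_toReal htop).1 (hlow y)
    have h1 : Real.exp (p * (r / 4 * ‖y‖) - (p + 1) * C) * (m / Vol f)
        ≤ (LpIntE p f y).toReal / Vol f := by
      rw [← mul_div_assoc]; gcongr
    have h2 := Real.log_le_log (by positivity) h1
    rw [Real.log_mul (Real.exp_pos _).ne' (by positivity), Real.log_exp] at h2
    rw [← EReal.coe_neg, erealExp_coe]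
    apply ENNReal.ofReal_le_ofReal
    apply Real.exp_le_exp.2
    have h3 := mul_le_mul_of_nonneg_left h2 (by positivity : 0 ≤ 1 / p)
    have h4 : 1 / p * (p * (r / 4 * ‖y‖) - (p + 1) * C + Real.log (m / Vol f))
      = r / 4 * ‖y‖ - 1 / p * ((p + 1) * C - Real.log (m / Vol f)) := by
      field_simp; ring
    linarith

lemma exists_normal {n : ℕ} {f : Euc n → EReal} (hf : InCvx f)
    (h0 : (0 : Euc n) ∉ interior {z : Euc n | f z ≠ ⊤}) :
    ∃ e : Euc n, ‖e‖ = 1 ∧ ∀ z, f z ≠ ⊤ → ⟪z, e⟫ ≤ 0 := by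
  have hcv := (convexOn_toReal hf.noBot hf.convex).1
  have hne := interior_nonempty hf
  obtain ⟨l, hl⟩ := geometric_hahn_banach_open_point hcv.interior isOpen_interior h0
  rw [map_zero] at hl
  have hl' : ∀ z, f z ≠ ⊤ → l z ≤ 0 := by
    intro z hz
    have hzc : z ∈ closure (interior {z : Euc n | f z ≠ ⊤}) := by
      rw [hcv.closure_interior_eq_closure_of_nonempty_interior hne]
      exact subset_closure hz
    exact closure_minimal (fun a ha => (hl a ha).le)
      (isClosed_le l.continuous continuous_const) hzc
  set u := (InnerProductSpace.toDual ℝ (Euc n)).symm l with hu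
  have hul : ∀ z, ⟪z, u⟫ = l z := fun z => by
    rw [real_inner_comm, hu, InnerProductSpace.toDual_symm_apply]
  have hu0 : 0 < ‖u‖ := by
    rw [norm_pos_iff]
    intro h
    obtain ⟨a, ha⟩ := hne
    have := hl a ha
    rw [← hul, h, inner_zero_right] at this
    exact lt_irrefl _ this
  refine ⟨‖u‖⁻¹ • u, ?_, fun z hz => ?_⟩
  · rw [norm_smul, norm_inv, norm_norm, inv_mul_cancel₀ hu0.ne']
  · rw [real_inner_smul_right, hul]
    exact mul_nonpos_of_nonneg_of_nonpos (by positivity) (hl' z hz)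

lemma infinite_of_notMem {n : ℕ} {p : ℝ} (hp : 0 < p) {f : Euc n → EReal} (hf : InCvx f)
    (h0 : (0 : Euc n) ∉ interior {z : Euc n | f z ≠ ⊤}) : VolE (LpStar p f) = ⊤ := by
  obtain ⟨e, he, hez⟩ := exists_normal hf h0
  obtain ⟨a, b, ha, hab⟩ := growth hf
  have hV := volReal_pos hf
  have hKtop := lintegral_exp_norm n a ((p + 1) * b) ha
  set K := ∫⁻ x : Euc n, ENNReal.ofReal (Real.exp (-a * ‖x‖ + (p + 1) * b)) with hK
  have hup : ∀ k : ℕ, ∀ y ∈ Metric.ball ((0 : Euc n) + ((k : ℝ) * a) • e) (a / 2),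
      LpIntE p f y ≤ K := by
    intro k y hy
    refine lintegral_mono fun x => ?_
    by_cases ht : f x = ⊤
    · rw [ht, EReal.coe_mul_top_of_pos (by linarith), EReal.sub_top]
      simp [erealExp]
    have hfx := hab x
    rw [← EReal.coe_toReal ht (hf.noBot x)] at hfx ⊢
    have hfx' : a * ‖x‖ - b ≤ (f x).toReal := by exact_mod_cast hfx
    rw [← EReal.coe_mul, ← EReal.coe_sub, erealExp_coe]
    apply ENNReal.ofReal_le_ofReal
    apply Real.exp_le_exp.2
    rw [zero_add] at hy
    have hv : ‖y - ((k : ℝ) * a) • e‖ < a / 2 := by rw [← dist_eq_norm]; exact hy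
    have hin : ⟪x, y⟫ ≤ a * ‖x‖ := by
      have e1 : ⟪x, y⟫ = ⟪x, y - ((k : ℝ) * a) • e⟫ + ((k : ℝ) * a) * ⟪x, e⟫ := by
        rw [← real_inner_smul_right, ← inner_add_right, sub_add_cancel]
      have h1 := real_inner_le_norm x (y - ((k : ℝ) * a) • e)
      have h2 : ((k : ℝ) * a) * ⟪x, e⟫ ≤ 0 :=
        mul_nonpos_of_nonneg_of_nonpos (by positivity) (hez x ht)
      have h3 := mul_le_mul_of_nonneg_left hv.le (norm_nonneg x)
      have h4 := mul_nonneg ha.le (norm_nonneg x)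
      rw [e1]; linarith
    have := mul_le_mul_of_nonneg_left hin hp.le
    have := mul_le_mul_of_nonneg_left hfx' (by linarith : 0 ≤ p + 1)
    linarith
  set c := ENNReal.ofReal (Real.exp (-(1 / p * (K.toReal / Vol f)))) with hc
  have hc0 : c * volume (Metric.ball (0 : Euc n) (a / 2)) ≠ 0 := by
    apply mul_ne_zero
    · simp [hc, Real.exp_pos]
    · exact (Metric.measure_ball_pos _ _ (by positivity)).ne'
  by_contra hfin
  obtain ⟨N, hN⟩ := ENNReal.exists_nat_mul_gt hc0 hfin
  refine absurd (balls_lintegral (fun y => erealExp (-(LpStar p f y))) c 0 e he a ha N ?_)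
    (not_le.2 hN)
  intro k _ y hy
  have h1 := hup k y hy
  have htop : LpIntE p f y ≠ ⊤ := ne_top_of_le_ne_top hKtop.ne h1
  unfold LpStar
  rw [if_neg htop, ← EReal.coe_neg, erealExp_coe]
  apply ENNReal.ofReal_le_ofReal
  apply Real.exp_le_exp.2
  have h2 : (LpIntE p f y).toReal ≤ K.toReal := ENNReal.toReal_mono hKtop.ne h1
  have h3 : Real.log ((LpIntE p f y).toReal / Vol f) ≤ (LpIntE p f y).toReal / Vol f :=
    Real.log_le_self (by positivity)
  have h4 : (LpIntE p f y).toReal / Vol f ≤ K.toReal / Vol f := by gcongr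
  have h5 := mul_le_mul_of_nonneg_left (h3.trans h4) (by positivity : 0 ≤ 1 / p)
  linarith

lemma inCvx_transl {n : ℕ} {φ : Euc n → EReal} (hφ : InCvx φ) (x : Euc n) :
    InCvx (Transl x φ) := by
  have hv : VolE (Transl x φ) = VolE φ :=
    lintegral_add_right_eq_self (fun z => erealExp (-(φ z))) x
  refine ⟨fun z => hφ.noBot _, ?_, ?_, ?_, ?_, ?_⟩
  · intro y z l h0 h1
    have := hφ.convex (y + x) (z + x) l h0 h1
    have e : (1 - l) • (y + x) + l • (z + x) = ((1 - l) • y + l • z) + x := by module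
    rw [e] at this
    exact this
  · exact hφ.lsc.comp (continuous_id.add continuous_const)
  · obtain ⟨z, hz⟩ := hφ.proper
    exact ⟨z - x, by simpa [Transl] using hz⟩
  · rw [hv]; exact hφ.volPos
  · rw [hv]; exact hφ.volFin

/-- finiteness of the translated `L^p`-Mahler integral:
for `φ ∈ Cvx(ℝⁿ)`, `V((T_x φ)^{*,p}) < ∞` iff `x ∈ int {φ < ∞}`. -/
theorem lp_mahler_finite_iff (n : ℕ) (p : ℝ) (hp : 0 < p)
    (φ : Euc n → EReal) (hφ : InCvx φ) (x : Euc n) :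
    VolE (LpStar p (Transl x φ)) < ⊤ ↔ x ∈ interior {z : Euc n | φ z ≠ ⊤} := by
  have hT := inCvx_transl hφ x
  have hpre : (0 : Euc n) ∈ interior {z : Euc n | Transl x φ z ≠ ⊤} ↔
      x ∈ interior {z : Euc n | φ z ≠ ⊤} := by
    have h := (Homeomorph.addRight x).preimage_interior {z : Euc n | φ z ≠ ⊤}
    have h2 : {z : Euc n | Transl x φ z ≠ ⊤}
        = (Homeomorph.addRight x) ⁻¹' {z : Euc n | φ z ≠ ⊤} := rfl
    rw [h2, ← h]
    simp
  rw [← hpre]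
  constructor
  · intro h
    by_contra hn
    exact h.ne (infinite_of_notMem hp hT hn)
  · exact finite_of_mem hp hT

end
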